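/- Let d be a natural number and let a ≥ b ≥ 2d. Then for every M ∈ GL(b,2), the transvection word length is preserved under embedding: δ(φ_{b,a}(M)) = δ(M). (In particular, for every c ≤ b, the map sending the orbit S_b·M to S_a·φ_{b,a}(M) is a bijection between the S_b-orbits of matrices in GL(b,2) at distance d with c essential indices and the S_a-orbits of matrices in GL(a,2) at distance d with c essential indices.) -/

import Mathlib

/-- The word length of `g` with respect to a set `S`: the least `k` such that
`g` is a product of `k` elements of `S`. -/
noncomputable def wordLen {G : Type*} [Monoid G] (S : Set G) (g : G) : ℕ :=
  sInf {k | ∃ l : List G, (∀ x ∈ l, x ∈ S) ∧ l.length = k ∧ l.prod = g}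

/-- The set of transvection matrices `T i j = 1 + E i j` (for `i ≠ j`) over `𝔽₂`. -/
def Tmats (n : ℕ) : Set (Matrix (Fin n) (Fin n) (ZMod 2)) :=
  {A | ∃ i j : Fin n, i ≠ j ∧ A = Matrix.transvection i j 1}

/-- The embedding of a `b × b` matrix over `𝔽₂` into the upper-left corner of an
`a × a` matrix, with the identity in the lower-right block and zeros elsewhere. -/
def embedMat (b a : ℕ) (M : Matrix (Fin b) (Fin b) (ZMod 2)) :
    Matrix (Fin a) (Fin a) (ZMod 2) :=
  fun i j =>
    if hi : (i : ℕ) < b then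
      if hj : (j : ℕ) < b then M ⟨i, hi⟩ ⟨j, hj⟩ else 0
    else if i = j then 1 else 0

open Matrix

/-- The product of the transvections `1 + E i j` over the pairs `(i, j)` in a list. -/
def transvectionWord {n : ℕ} (w : List (Fin n × Fin n)) : Matrix (Fin n) (Fin n) (ZMod 2) :=
  (w.map fun p => transvection p.1 p.2 1).prod

/-- The indices occurring in a list of pairs. -/
def touchedIndices {n : ℕ} (w : List (Fin n × Fin n)) : Finset (Fin n) :=
  (w.map Prod.fst).toFinset ∪ (w.map Prod.snd).toFinset

theorem transvectionWord_cons {n : ℕ} (p : Fin n × Fin n) (w : List (Fin n × Fin n)) :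
    transvectionWord (p :: w) = transvection p.1 p.2 1 * transvectionWord w := by
  simp [transvectionWord]

theorem transvection_mul_apply {n : ℕ} (i j p q : Fin n) (N : Matrix (Fin n) (Fin n) (ZMod 2)) :
    (Matrix.transvection i j (1 : ZMod 2) * N) p q = N p q + if p = i then N j q else 0 := by
  split_ifs with h
  · subst h
    simp
  · simp [transvection_mul_apply_of_ne _ _ _ _ h]

theorem card_touchedIndices_le {n : ℕ} (w : List (Fin n × Fin n)) :
    (touchedIndices w).card ≤ 2 * w.length := by
  have h₁ := (w.map Prod.fst).toFinset_card_le
  have h₂ := (w.map Prod.snd).toFinset_card_le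
  have h := Finset.card_union_le (w.map Prod.fst).toFinset (w.map Prod.snd).toFinset
  simp only [List.length_map] at h₁ h₂
  unfold touchedIndices
  omega

theorem mem_touchedIndices_cons {n : ℕ} {p : Fin n × Fin n} {w : List (Fin n × Fin n)}
    {i : Fin n} : i ∈ touchedIndices (p :: w) ↔ i = p.1 ∨ i = p.2 ∨ i ∈ touchedIndices w := by
  simp only [touchedIndices, List.map_cons, List.toFinset_cons, Finset.mem_union,
    Finset.mem_insert]
  tauto

theorem transvectionWord_apply_of_notMem {n : ℕ} (w : List (Fin n × Fin n)) {i j : Fin n}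
    (h : i ∉ touchedIndices w ∨ j ∉ touchedIndices w) :
    transvectionWord w i j = (1 : Matrix (Fin n) (Fin n) (ZMod 2)) i j := by
  induction w generalizing i j with
  | nil => simp [transvectionWord]
  | cons p w ih =>
    simp only [mem_touchedIndices_cons, not_or] at h
    rw [transvectionWord_cons, transvection_mul_apply]
    rcases h with h | h
    · rw [if_neg h.1, add_zero, ih (Or.inl h.2.2)]
    · rw [ih (Or.inr h.2.2), ih (Or.inr h.2.2), one_apply_ne (Ne.symm h.2.1)]
      simp

theorem transvectionWord_map_submatrix {m n : ℕ} {e : Fin m → Fin n} (he : e.Injective)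
    (w : List (Fin m × Fin m)) :
    (transvectionWord (w.map (Prod.map e e))).submatrix e e = transvectionWord w := by
  induction w with
  | nil => simp [transvectionWord, submatrix_one _ he]
  | cons p w ih =>
    ext i j
    simp only [List.map_cons, transvectionWord_cons, submatrix_apply, transvection_mul_apply,
      Prod.map_fst, Prod.map_snd, he.eq_iff, ← ih]

theorem embedMat_one (b a : ℕ) : embedMat b a 1 = 1 := by
  ext i j
  simp only [embedMat, one_apply, Fin.ext_iff]
  split_ifs <;> first | rfl | omega

theorem embedMat_transvection_mul {b a : ℕ} (hba : b ≤ a) (i j : Fin b)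
    (N : Matrix (Fin b) (Fin b) (ZMod 2)) :
    embedMat b a (transvection i j 1 * N) =
      transvection (Fin.castLE hba i) (Fin.castLE hba j) 1 * embedMat b a N := by
  ext p q
  rw [transvection_mul_apply]
  simp only [embedMat, transvection_mul_apply, Fin.ext_iff, Fin.val_castLE, Fin.is_lt, dif_pos]
  have := i.is_lt
  split_ifs <;> first | omega | simp

theorem embedMat_transvectionWord {b a : ℕ} (hba : b ≤ a) (w : List (Fin b × Fin b)) :
    embedMat b a (transvectionWord w) =
      transvectionWord (w.map (Prod.map (Fin.castLE hba) (Fin.castLE hba))) := by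
  induction w with
  | nil => simp [transvectionWord, embedMat_one]
  | cons p w ih =>
    rw [List.map_cons, transvectionWord_cons, transvectionWord_cons, embedMat_transvection_mul hba,
      ih, Prod.map_fst, Prod.map_snd]

theorem exists_transvectionWord_of_forall_mem {n : ℕ} (l : List (Matrix (Fin n) (Fin n) (ZMod 2)))
    (hl : ∀ x ∈ l, x ∈ Tmats n) :
    ∃ w : List (Fin n × Fin n), (∀ p ∈ w, p.1 ≠ p.2) ∧ w.length = l.length ∧
      transvectionWord w = l.prod := by
  induction l with
  | nil => exact ⟨[], by simp [transvectionWord]⟩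
  | cons x l ih =>
    obtain ⟨w, hw, hlen, hprod⟩ := ih fun y hy => hl y (List.mem_cons_of_mem _ hy)
    obtain ⟨i, j, hij, rfl⟩ := hl x List.mem_cons_self
    refine ⟨(i, j) :: w, ?_, by simp [hlen], by simp [transvectionWord_cons, hprod]⟩
    simpa [hij] using hw

theorem wordLen_transvectionWord_le {n : ℕ} {w : List (Fin n × Fin n)}
    (hw : ∀ p ∈ w, p.1 ≠ p.2) : wordLen (Tmats n) (transvectionWord w) ≤ w.length := by
  refine Nat.sInf_le ⟨w.map fun p => transvection p.1 p.2 1, ?_, by simp, rfl⟩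
  intro x hx
  obtain ⟨p, hp, rfl⟩ := List.mem_map.1 hx
  exact ⟨p.1, p.2, hw p hp, rfl⟩

theorem exists_transvectionWord_length_eq_wordLen {n : ℕ} {g : Matrix (Fin n) (Fin n) (ZMod 2)}
    (hg : g ∈ Submonoid.closure (Tmats n)) :
    ∃ w : List (Fin n × Fin n), (∀ p ∈ w, p.1 ≠ p.2) ∧ w.length = wordLen (Tmats n) g ∧
      transvectionWord w = g := by
  obtain ⟨l₀, hl₀, hprod₀⟩ := Submonoid.exists_list_of_mem_closure hg
  obtain ⟨l, hl, hlen, hprod⟩ := Nat.sInf_mem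
    (s := {k | ∃ l : List _, (∀ x ∈ l, x ∈ Tmats n) ∧ l.length = k ∧ l.prod = g})
    ⟨l₀.length, l₀, hl₀, rfl, hprod₀⟩
  obtain ⟨w, hw, hwlen, hwprod⟩ := exists_transvectionWord_of_forall_mem l hl
  exact ⟨w, hw, hwlen.trans hlen, hwprod.trans hprod⟩

theorem transvectionWord_mem_closure {n : ℕ} {w : List (Fin n × Fin n)}
    (hw : ∀ p ∈ w, p.1 ≠ p.2) : transvectionWord w ∈ Submonoid.closure (Tmats n) := by
  refine Submonoid.list_prod_mem _ fun x hx => ?_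
  obtain ⟨p, hp, rfl⟩ := List.mem_map.1 hx
  exact Submonoid.subset_closure ⟨p.1, p.2, hw p hp, rfl⟩

theorem TransvectionStruct.toMatrix_mem_closure_Tmats {n : ℕ}
    (t : TransvectionStruct (Fin n) (ZMod 2)) : t.toMatrix ∈ Submonoid.closure (Tmats n) := by
  obtain ⟨i, j, hij, c⟩ := t
  obtain rfl | rfl : c = 0 ∨ c = 1 := by
    revert c
    decide
  · simp [TransvectionStruct.toMatrix, one_mem]
  · exact Submonoid.subset_closure ⟨i, j, hij, rfl⟩

theorem GL_mem_closure_Tmats {n : ℕ} (M : GL (Fin n) (ZMod 2)) :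
    (M : Matrix (Fin n) (Fin n) (ZMod 2)) ∈ Submonoid.closure (Tmats n) := by
  obtain ⟨L, L', D, h⟩ := Pivot.exists_list_transvec_mul_diagonal_mul_list_transvec
    (M : Matrix (Fin n) (Fin n) (ZMod 2))
  have hdet : (M : Matrix (Fin n) (Fin n) (ZMod 2)).det ≠ 0 :=
    ((isUnit_iff_isUnit_det _).1 M.isUnit).ne_zero
  have hD : diagonal D = 1 := by
    rw [← diagonal_one, diagonal_eq_diagonal_iff]
    intro i
    rw [h, det_mul, det_mul, det_diagonal] at hdet
    have hi : D i ≠ 0 := Finset.prod_ne_zero_iff.1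
      (right_ne_zero_of_mul (left_ne_zero_of_mul hdet)) i (Finset.mem_univ i)
    generalize D i = c at hi
    revert c
    decide
  have hmem (L : List (TransvectionStruct (Fin n) (ZMod 2))) :
      (L.map TransvectionStruct.toMatrix).prod ∈ Submonoid.closure (Tmats n) := by
    refine Submonoid.list_prod_mem _ fun x hx => ?_
    obtain ⟨t, -, rfl⟩ := List.mem_map.1 hx
    exact TransvectionStruct.toMatrix_mem_closure_Tmats t
  rw [h, hD, mul_one]
  exact mul_mem (hmem L) (hmem L')

/-- A set of at most `b` indices lies in the range of an injection `Fin b → Fin a` that fixes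
every small index of the set and sends each index it moves to a large one. -/
theorem exists_injective_covering {b a : ℕ} (hba : b ≤ a) (U : Finset (Fin a))
    (hU : U.card ≤ b) :
    ∃ e : Fin b → Fin a, e.Injective ∧ (∀ u ∈ U, ∃ i, e i = u) ∧
      ∀ i, e i = Fin.castLE hba i ∨ (Fin.castLE hba i ∉ U ∧ b ≤ (e i : ℕ)) := by
  let high : Finset (Fin a) := U.filter fun u => b ≤ (u : ℕ)
  let low : Finset (Fin b) := Finset.univ.filter fun i : Fin b => Fin.castLE hba i ∈ U
  have hcard : Fintype.card high ≤ Fintype.card (lowᶜ : Finset (Fin b)) := by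
    have hdisj : Disjoint high (low.map (Fin.castLEEmb hba)) := by
      rw [Finset.disjoint_left]
      intro u hu hu'
      obtain ⟨i, -, rfl⟩ := Finset.mem_map.1 hu'
      have := (Finset.mem_filter.1 hu).2
      simp at this
      omega
    have hsub : high.disjUnion _ hdisj ⊆ U := by
      intro u hu
      rcases Finset.mem_disjUnion.1 hu with hu | hu
      · exact (Finset.mem_filter.1 hu).1
      · obtain ⟨i, hi, rfl⟩ := Finset.mem_map.1 hu
        exact (Finset.mem_filter.1 hi).2
    have hle := Finset.card_le_card hsub
    rw [Finset.card_disjUnion, Finset.card_map] at hle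
    rw [Fintype.card_coe, Fintype.card_coe, Finset.card_compl, Fintype.card_fin]
    omega
  obtain ⟨f⟩ := Function.Embedding.nonempty_of_card_le hcard
  let g : high → Fin b := fun u => f u
  have hg : g.Injective := Subtype.val_injective.comp f.injective
  let e : Fin b → Fin a := Function.extend g Subtype.val (Fin.castLE hba)
  have heg (u : high) : e (g u) = u := hg.extend_apply _ _ u
  have heo (i : Fin b) (hi : ¬∃ u, g u = i) : e i = Fin.castLE hba i :=
    Function.extend_apply' _ _ _ hi
  have hhigh (u : high) : b ≤ ((u : Fin a) : ℕ) := (Finset.mem_filter.1 u.2).2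
  have hgU (u : high) : Fin.castLE hba (g u) ∉ U := fun h =>
    Finset.mem_compl.1 (f u).2 (Finset.mem_filter.2 ⟨Finset.mem_univ _, h⟩)
  refine ⟨e, ?_, ?_, ?_⟩
  · intro i j hij
    by_cases hi : ∃ u, g u = i <;> by_cases hj : ∃ v, g v = j
    · obtain ⟨u, rfl⟩ := hi
      obtain ⟨v, rfl⟩ := hj
      rw [heg, heg] at hij
      rw [Subtype.ext hij]
    · obtain ⟨u, rfl⟩ := hi
      rw [heg, heo j hj] at hij
      have := hhigh u
      rw [hij, Fin.val_castLE] at this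
      omega
    · obtain ⟨v, rfl⟩ := hj
      rw [heg, heo i hi] at hij
      have := hhigh v
      rw [← hij, Fin.val_castLE] at this
      omega
    · rw [heo i hi, heo j hj] at hij
      exact Fin.castLE_injective hba hij
  · intro u hu
    by_cases hub : b ≤ (u : ℕ)
    · exact ⟨_, heg ⟨u, Finset.mem_filter.2 ⟨hu, hub⟩⟩⟩
    · refine ⟨⟨u, by omega⟩, heo _ ?_⟩
      rintro ⟨v, hv⟩
      apply hgU v
      rw [hv]
      exact hu
  · intro i
    by_cases hi : ∃ u, g u = i
    · obtain ⟨u, rfl⟩ := hi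
      exact Or.inr ⟨hgU u, (heg u).symm ▸ hhigh u⟩
    · exact Or.inl (heo i hi)

theorem embedMat_castLE {b a : ℕ} (hba : b ≤ a) (M : Matrix (Fin b) (Fin b) (ZMod 2))
    (i j : Fin b) : embedMat b a M (Fin.castLE hba i) (Fin.castLE hba j) = M i j := by
  simp [embedMat]

theorem embedMat_apply_of_le {b a : ℕ} (M : Matrix (Fin b) (Fin b) (ZMod 2)) {i j : Fin a}
    (h : b ≤ (i : ℕ) ∨ b ≤ (j : ℕ)) :
    embedMat b a M i j = (1 : Matrix (Fin a) (Fin a) (ZMod 2)) i j := by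
  simp only [embedMat, one_apply, Fin.ext_iff]
  split_ifs <;> first | rfl | omega

/-- A short word for an embedded matrix can be relabelled to a word for the matrix itself. -/
theorem exists_transvectionWord_of_embedMat {b a : ℕ} (hba : b ≤ a)
    (M : Matrix (Fin b) (Fin b) (ZMod 2)) {w : List (Fin a × Fin a)} (hw : ∀ p ∈ w, p.1 ≠ p.2)
    (hlen : 2 * w.length ≤ b) (hM : transvectionWord w = embedMat b a M) :
    ∃ w' : List (Fin b × Fin b), (∀ p ∈ w', p.1 ≠ p.2) ∧ w'.length = w.length ∧
      transvectionWord w' = M := by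
  obtain ⟨e, he, hcov, hfix⟩ :=
    exists_injective_covering hba (touchedIndices w) ((card_touchedIndices_le w).trans hlen)
  obtain ⟨w', rfl⟩ : ∃ w' : List (Fin b × Fin b), w'.map (Prod.map e e) = w := by
    change w ∈ Set.range (List.map (Prod.map e e))
    rw [Set.range_list_map]
    intro p hp
    obtain ⟨i, hi⟩ := hcov p.1 (by
      simp only [touchedIndices, Finset.mem_union, List.mem_toFinset]
      exact Or.inl (List.mem_map_of_mem hp))
    obtain ⟨j, hj⟩ := hcov p.2 (by
      simp only [touchedIndices, Finset.mem_union, List.mem_toFinset]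
      exact Or.inr (List.mem_map_of_mem hp))
    exact ⟨(i, j), Prod.ext hi hj⟩
  refine ⟨w', fun p hp h => hw _ (List.mem_map_of_mem hp) (congrArg e h), by simp, ?_⟩
  rw [← transvectionWord_map_submatrix he]
  have moved {i j : Fin b}
      (h : Fin.castLE hba i ∉ touchedIndices (w'.map (Prod.map e e)) ∧ b ≤ (e i : ℕ) ∨
        Fin.castLE hba j ∉ touchedIndices (w'.map (Prod.map e e)) ∧ b ≤ (e j : ℕ)) :
      embedMat b a M (e i) (e j) = M i j := by
    rw [embedMat_apply_of_le M (h.imp And.right And.right), ← embedMat_castLE hba M, ← hM,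
      transvectionWord_apply_of_notMem _ (h.imp And.left And.left)]
    simp only [one_apply, he.eq_iff, (Fin.castLE_injective hba).eq_iff]
  ext i j
  rw [hM, submatrix_apply]
  rcases hfix i with hi | hi
  · rcases hfix j with hj | hj
    · rw [hi, hj, embedMat_castLE]
    · exact moved (Or.inr hj)
  · exact moved (Or.inl hi)

theorem wordLen_preserved_under_embedding (d b a : ℕ) (hb : 2 * d ≤ b) (hba : b ≤ a)
    (M : GL (Fin b) (ZMod 2))
    (hd : wordLen (Tmats b) (M : Matrix (Fin b) (Fin b) (ZMod 2)) = d) :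
    wordLen (Tmats a) (embedMat b a (M : Matrix (Fin b) (Fin b) (ZMod 2)))
      = wordLen (Tmats b) (M : Matrix (Fin b) (Fin b) (ZMod 2)) := by
  obtain ⟨w, hw, hwlen, hwM⟩ := exists_transvectionWord_length_eq_wordLen (GL_mem_closure_Tmats M)
  have hinj := Fin.castLE_injective hba
  have hne : ∀ p ∈ w.map (Prod.map (Fin.castLE hba) (Fin.castLE hba)), p.1 ≠ p.2 := by
    intro p hp
    obtain ⟨q, hq, rfl⟩ := List.mem_map.1 hp
    exact hinj.ne (hw q hq)
  have hemb := embedMat_transvectionWord hba w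
  rw [hwM] at hemb
  have hle : wordLen (Tmats a) (embedMat b a (M : Matrix (Fin b) (Fin b) (ZMod 2)))
      ≤ wordLen (Tmats b) (M : Matrix (Fin b) (Fin b) (ZMod 2)) := by
    rw [hemb, ← hwlen]
    simpa using wordLen_transvectionWord_le hne
  obtain ⟨v, hv, hvlen, hvM⟩ := exists_transvectionWord_length_eq_wordLen
    (hemb ▸ transvectionWord_mem_closure hne)
  obtain ⟨v', hv', hvlen', hvM'⟩ :=
    exists_transvectionWord_of_embedMat hba _ hv (by omega) hvM
  refine le_antisymm hle ?_
  rw [← hvlen, ← hvlen', ← hvM']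
  exact wordLen_transvectionWord_le hv'
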